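/- arXiv:math/0310272 — 3 statements merged into one kernel-verified Lean document; each statement's English description precedes it below -/
import Mathlib

section
/- Sum formula for disconnected double Hurwitz numbers: for every positive integer d, all partitions μ¹, μ³ of d, and all λ₁, λ₂ ∈ ℂ, one has Σ_{μ² a partition of d} Φ•_{μ¹,μ²}(λ₁) · z_{μ²} · Φ•_{μ²,μ³}(λ₂) = Φ•_{μ¹,μ³}(λ₁ + λ₂). -/
open scoped BigOperators Classical

noncomputable section

namespace DoubleHurwitz

/-- The cycle type of a permutation of `{1, …, d}`, counting fixed points as cycles of
length 1 (Mathlib's `Equiv.Perm.cycleType` records only the nontrivial cycles). -/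
def fullCycleType {d : ℕ} (σ : Equiv.Perm (Fin d)) : Multiset ℕ :=
  σ.cycleType + Multiset.replicate (d - σ.cycleType.sum) 1

/-- `σ` has cycle type `μ`, where fixed points count as cycles of length 1. -/
def HasCycleType {d : ℕ} (σ : Equiv.Perm (Fin d)) (μ : Nat.Partition d) : Prop :=
  fullCycleType σ = μ.parts

/-- `z_μ = ∏_{j ≥ 1} m_j(μ)! · j^{m_j(μ)}` where `m_j(μ)` is the number of parts equal
to `j` (all parts lie in `{1, …, d}`). -/
def zPart {d : ℕ} (μ : Nat.Partition d) : ℕ :=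
  ∏ j ∈ Finset.Icc 1 d, Nat.factorial (μ.parts.count j) * j ^ (μ.parts.count j)

/-- `χ : S_d → ℂ` is an irreducible (complex) character: the character of some simple
finite-dimensional complex representation of `S_d`. -/
def IsIrredChar (d : ℕ) (χ : Equiv.Perm (Fin d) → ℂ) : Prop :=
  ∃ V : FDRep ℂ (Equiv.Perm (Fin d)), CategoryTheory.Simple V ∧ χ = V.character

/-- The (finite) type of irreducible complex characters of `S_d`. -/
def IrredChar (d : ℕ) : Type :=
  {χ : Equiv.Perm (Fin d) → ℂ // IsIrredChar d χ}

/-- `f_χ = (d(d−1)/2)·χ(t)/χ(1)` for any transposition `t`.  Since characters are class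
functions and the `d(d−1)/2` transpositions form a single conjugacy class, this value
equals the sum of `χ(t)/χ(1)` over all transpositions `t`, which is how we encode it
(this avoids an arbitrary choice of transposition, and gives `0` when `d = 1`,
matching `d(d−1)/2 = 0`). -/
def fChar {d : ℕ} (χ : Equiv.Perm (Fin d) → ℂ) : ℂ :=
  ∑ t ∈ Finset.univ.filter (fun t : Equiv.Perm (Fin d) => t.IsSwap), χ t / χ 1

/-- The disconnected double Hurwitz generating function
`Φ•_{μ,ν}(λ) = Σ_χ (χ(σ_μ)/z_μ)·(χ(σ_ν)/z_ν)·e^{f_χ λ}`, the sum ranging over the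
irreducible complex characters of `S_d`, where `rep` is a choice of a permutation
`σ_μ = rep μ` of each cycle type `μ`. -/
def Phi {d : ℕ} (rep : Nat.Partition d → Equiv.Perm (Fin d)) (μ ν : Nat.Partition d)
    (lam : ℂ) : ℂ :=
  ∑ᶠ χ : IrredChar d,
    (χ.1 (rep μ) / zPart μ) * (χ.1 (rep ν) / zPart ν) * Complex.exp (fChar χ.1 * lam)

end DoubleHurwitz

namespace DoubleHurwitz

open Equiv.Perm

variable {d : ℕ}

theorem cycleType_sum_le (σ : Equiv.Perm (Fin d)) : σ.cycleType.sum ≤ d := by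
  simpa using σ.sum_cycleType_le

theorem exists_hasCycleType (σ : Equiv.Perm (Fin d)) : ∃ μ, HasCycleType σ μ := by
  refine ⟨⟨fullCycleType σ, fun {i} hi => ?_, ?_⟩, rfl⟩
  · rcases Multiset.mem_add.mp hi with h | h
    · exact zero_lt_one.trans (one_lt_of_mem_cycleType h)
    · rw [Multiset.eq_of_mem_replicate h]
      exact zero_lt_one
  · have := cycleType_sum_le σ
    simp only [fullCycleType, Multiset.sum_add, Multiset.sum_replicate, smul_eq_mul, mul_one]
    omega

theorem filter_fullCycleType (σ : Equiv.Perm (Fin d)) :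
    (fullCycleType σ).filter (2 ≤ ·) = σ.cycleType := by
  rw [fullCycleType, Multiset.filter_add,
    Multiset.filter_eq_self.mpr fun _ h => two_le_of_mem_cycleType h,
    Multiset.filter_eq_nil.mpr, add_zero]
  intro a ha
  rw [Multiset.eq_of_mem_replicate ha]
  norm_num

theorem HasCycleType.iff_cycleType_eq {σ τ : Equiv.Perm (Fin d)} {μ : Nat.Partition d}
    (h : HasCycleType σ μ) : HasCycleType τ μ ↔ τ.cycleType = σ.cycleType := by
  unfold HasCycleType at *
  rw [← h]
  constructor
  · intro e
    rw [← filter_fullCycleType, e, filter_fullCycleType]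
  · intro e
    simp only [fullCycleType, e]

theorem zPart_eq {σ : Equiv.Perm (Fin d)} {μ : Nat.Partition d} (h : HasCycleType σ μ) :
    zPart μ = Nat.factorial (d - σ.cycleType.sum) * σ.cycleType.prod *
      ∏ n ∈ σ.cycleType.toFinset, Nat.factorial (σ.cycleType.count n) := by
  have hle : ∀ n ∈ μ.parts, n ∈ Finset.Icc 1 d := fun n hn =>
    Finset.mem_Icc.mpr ⟨μ.parts_pos hn, by
      simpa [μ.parts_sum] using Multiset.single_le_sum (fun _ _ => Nat.zero_le _) n hn⟩
  have hcount : ∀ j ≠ 1, μ.parts.count j = σ.cycleType.count j := fun j hj => by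
    rw [← h, fullCycleType, Multiset.count_add, Multiset.count_replicate, if_neg hj.symm, add_zero]
  have hone : σ.cycleType.count 1 = 0 :=
    Multiset.count_eq_zero.mpr fun hm => absurd (two_le_of_mem_cycleType hm) (by norm_num)
  have hprod : ∏ j ∈ Finset.Icc 1 d, j ^ μ.parts.count j = σ.cycleType.prod := by
    rw [← Finset.prod_multiset_count_of_subset μ.parts (Finset.Icc 1 d)
      fun n hn => hle n (Multiset.mem_toFinset.mp hn), ← h, fullCycleType]
    simp
  have hfact : ∏ j ∈ Finset.Icc 1 d, Nat.factorial (μ.parts.count j) =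
      Nat.factorial (d - σ.cycleType.sum) *
        ∏ n ∈ σ.cycleType.toFinset, Nat.factorial (σ.cycleType.count n) := by
    rcases Nat.eq_zero_or_pos d with rfl | hd
    · have : σ.cycleType = 0 := by
        rw [cycleType_eq_zero]
        exact Subsingleton.elim _ _
      simp [this]
    rw [← Finset.mul_prod_erase _ _ (Finset.mem_Icc.mpr ⟨le_rfl, hd⟩)]
    congr 1
    · rw [← h, fullCycleType, Multiset.count_add, hone, Multiset.count_replicate_self, zero_add]
    · rw [Finset.prod_congr rfl fun _ hj => by rw [hcount _ (Finset.ne_of_mem_erase hj)]]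
      refine (Finset.prod_subset (fun n hn => ?_) fun n _ hn => ?_).symm
      · have hn := Multiset.mem_toFinset.mp hn
        have h2 := two_le_of_mem_cycleType hn
        refine Finset.mem_erase.mpr ⟨by omega, hle n ?_⟩
        rw [← h]
        exact Multiset.mem_add.mpr (Or.inl hn)
      · rw [Multiset.count_eq_zero.mpr fun hm => hn (Multiset.mem_toFinset.mpr hm),
          Nat.factorial_zero]
  rw [zPart, Finset.prod_mul_distrib, hprod, hfact]
  ring

theorem card_hasCycleType_mul_zPart {σ : Equiv.Perm (Fin d)} {μ : Nat.Partition d}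
    (h : HasCycleType σ μ) :
    (Finset.univ.filter fun τ : Equiv.Perm (Fin d) => HasCycleType τ μ).card * zPart μ =
      Nat.factorial d := by
  have := card_of_cycleType_mul_eq (Fin d) σ.cycleType
  rw [if_pos ⟨by simpa using cycleType_sum_le σ, fun _ => two_le_of_mem_cycleType⟩,
    Fintype.card_fin] at this
  rw [← this, zPart_eq h]
  congr 2
  ext τ
  simp [h.iff_cycleType_eq]

theorem zPart_ne_zero (μ : Nat.Partition d) : zPart μ ≠ 0 :=
  Finset.prod_ne_zero_iff.mpr fun _ hj =>
    mul_ne_zero (Nat.factorial_ne_zero _)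
      (pow_ne_zero _ (Nat.one_le_iff_ne_zero.mp (Finset.mem_Icc.mp hj).1))

theorem sum_div_zPart {rep : Nat.Partition d → Equiv.Perm (Fin d)}
    (hrep : ∀ μ, HasCycleType (rep μ) μ) (F : Equiv.Perm (Fin d) → ℂ)
    (hF : ∀ σ τ, IsConj σ τ → F σ = F τ) :
    ∑ μ, F (rep μ) / zPart μ = (Nat.factorial d : ℂ)⁻¹ * ∑ σ, F σ := by
  choose p hp using exists_hasCycleType (d := d)
  rw [← Finset.sum_fiberwise Finset.univ p F, Finset.mul_sum]
  refine Finset.sum_congr rfl fun μ _ => ?_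
  have hiff : ∀ τ, p τ = μ ↔ HasCycleType τ μ := fun τ =>
    ⟨fun e => e ▸ hp τ, fun e => Nat.Partition.ext ((hp τ).symm.trans e)⟩
  have hconst : ∀ τ ∈ Finset.univ.filter (fun τ => p τ = μ), F τ = F (rep μ) := fun τ hτ =>
    hF _ _ (isConj_iff_cycleType_eq.mpr
      ((hrep μ).iff_cycleType_eq.mp ((hiff τ).mp (Finset.mem_filter.mp hτ).2)))
  rw [Finset.sum_congr rfl hconst, Finset.sum_const, nsmul_eq_mul,
    ← card_hasCycleType_mul_zPart (hrep μ)]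
  simp only [hiff]
  have hz : (zPart μ : ℂ) ≠ 0 := Nat.cast_ne_zero.mpr (zPart_ne_zero μ)
  have hc : ((Finset.univ.filter fun τ : Equiv.Perm (Fin d) => HasCycleType τ μ).card : ℂ) ≠ 0 := by
    refine Nat.cast_ne_zero.mpr (Finset.card_ne_zero_of_mem (a := rep μ) ?_)
    simpa using hrep μ
  push_cast
  field_simp

theorem IsIrredChar.eq_of_isConj {χ : Equiv.Perm (Fin d) → ℂ} (h : IsIrredChar d χ)
    {σ τ : Equiv.Perm (Fin d)} (hc : IsConj σ τ) : χ σ = χ τ := by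
  obtain ⟨V, -, rfl⟩ := h
  obtain ⟨c, rfl⟩ := isConj_iff.mp hc
  exact (V.char_conj σ c).symm

theorem isConj_inv_self (σ : Equiv.Perm (Fin d)) : IsConj σ⁻¹ σ :=
  isConj_iff_cycleType_eq.mpr σ.cycleType_inv

theorem irredChar_orthonormal (χ ψ : IrredChar d) :
    (Nat.factorial d : ℂ)⁻¹ * ∑ σ, χ.1 σ * ψ.1 σ = if χ = ψ then 1 else 0 := by
  obtain ⟨V, hV, hχ⟩ := χ.2
  obtain ⟨W, hW, hψ⟩ := ψ.2
  have hcard : Nat.card (Equiv.Perm (Fin d)) = Nat.factorial d := by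
    simp [Nat.card_eq_fintype_card, Fintype.card_perm]
  have : Invertible (Nat.card (Equiv.Perm (Fin d)) : ℂ) :=
    invertibleOfNonzero (Nat.cast_ne_zero.mpr Nat.card_pos.ne')
  have key := fun U : FDRep ℂ (Equiv.Perm (Fin d)) => fun (_ : CategoryTheory.Simple U) =>
    FDRep.char_orthonormal U W
  simp only [hcard, ← hψ, fun σ => ψ.2.eq_of_isConj (isConj_inv_self σ)] at key
  rw [hχ, key V hV]
  congr 1
  refine propext ⟨fun ⟨i⟩ => Subtype.ext ?_, fun e => ?_⟩
  · rw [hχ, hψ, FDRep.char_iso i]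
  · have h1 := key V hV
    have h2 := key W hW
    rw [if_pos ⟨CategoryTheory.Iso.refl W⟩, ← hψ, ← e, hχ] at h2
    rw [← e, hχ, h2] at h1
    by_contra hne
    rw [if_neg hne] at h1
    exact one_ne_zero h1

theorem linearIndependent_irredChar :
    LinearIndependent ℂ (fun χ : IrredChar d => χ.1) := by
  rw [linearIndependent_iff']
  intro s g hg ψ hψ
  have h : (Nat.factorial d : ℂ)⁻¹ * ∑ σ, (∑ χ ∈ s, g χ • χ.1) σ * ψ.1 σ = 0 := by
    rw [hg]
    simp
  simp only [Finset.sum_apply, Pi.smul_apply, smul_eq_mul, Finset.sum_mul, mul_assoc] at h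
  rw [Finset.sum_comm, Finset.mul_sum] at h
  simp only [← Finset.mul_sum, mul_left_comm _ (g _), irredChar_orthonormal] at h
  simpa [hψ] using h

instance : Finite (IrredChar d) :=
  linearIndependent_irredChar.finite

theorem sum_irredChar_mul_div_zPart {rep : Nat.Partition d → Equiv.Perm (Fin d)}
    (hrep : ∀ μ, HasCycleType (rep μ) μ) (χ ψ : IrredChar d) :
    ∑ μ, χ.1 (rep μ) * ψ.1 (rep μ) / zPart μ = if χ = ψ then 1 else 0 := by
  rw [← irredChar_orthonormal, ← sum_div_zPart hrep (fun σ => χ.1 σ * ψ.1 σ)]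
  intro σ τ h
  rw [χ.2.eq_of_isConj h, ψ.2.eq_of_isConj h]

end DoubleHurwitz

open DoubleHurwitz in
/-- **Sum formula for disconnected double Hurwitz numbers.** -/
theorem sum_formula_double_hurwitz (d : ℕ) (hd : 0 < d)
    (rep : Nat.Partition d → Equiv.Perm (Fin d))
    (hrep : ∀ μ : Nat.Partition d, HasCycleType (rep μ) μ)
    (μ1 μ3 : Nat.Partition d) (lam1 lam2 : ℂ) :
    ∑ μ2 : Nat.Partition d,
        Phi rep μ1 μ2 lam1 * (zPart μ2 : ℂ) * Phi rep μ2 μ3 lam2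
      = Phi rep μ1 μ3 (lam1 + lam2) := by
  have := Fintype.ofFinite (IrredChar d)
  simp only [Phi, finsum_eq_sum_of_fintype]
  have hz (μ : Nat.Partition d) : (zPart μ : ℂ) ≠ 0 := Nat.cast_ne_zero.mpr (zPart_ne_zero μ)
  calc
    _ = ∑ χ : IrredChar d, ∑ ψ : IrredChar d,
          (χ.1 (rep μ1) / zPart μ1 * Complex.exp (fChar χ.1 * lam1)) *
          (ψ.1 (rep μ3) / zPart μ3 * Complex.exp (fChar ψ.1 * lam2)) *
          ∑ μ, χ.1 (rep μ) * ψ.1 (rep μ) / zPart μ := by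
      simp only [Finset.sum_mul _ _ (zPart _ : ℂ), Finset.sum_mul_sum]
      simp only [Finset.mul_sum]
      rw [Finset.sum_comm]
      refine Finset.sum_congr rfl fun χ _ => ?_
      rw [Finset.sum_comm]
      refine Finset.sum_congr rfl fun ψ _ => Finset.sum_congr rfl fun μ _ => ?_
      have := hz μ
      field_simp
    _ = _ := by
      simp only [sum_irredChar_mul_div_zPart hrep, mul_ite, mul_one, mul_zero,
        Finset.sum_ite_eq, Finset.mem_univ, if_true]
      refine Finset.sum_congr rfl fun χ _ => ?_
      rw [mul_add, Complex.exp_add]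
      ring
end
end

section
/- Parity relation for double Hurwitz generating functions: for every positive integer d, all partitions μ, ν of d, and all λ ∈ ℂ, one has Φ•_{μ,ν}(−λ) = (−1)^{l(μ)+l(ν)} · Φ•_{μ,ν}(λ); equivalently, Φ•_{μ,ν}(λ) = (−1)^{l(μ)+l(ν)} Σ_χ (χ(σ_μ)/z_μ)(χ(σ_ν)/z_ν) e^{−f_χ λ}, the sum over irreducible complex characters χ of S_d. -/
open scoped BigOperators Classical

noncomputable section

namespace DoubleHurwitz

open Equiv.Perm

/-- The sign of a permutation as a complex number. -/
def signC {d : ℕ} : Equiv.Perm (Fin d) →* ℂ :=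
  (Int.castRingHom ℂ).toMonoidHom.comp ((Units.coeHom ℤ).comp sign)

theorem signC_apply {d : ℕ} (σ : Equiv.Perm (Fin d)) : signC σ = ((sign σ : ℤ) : ℂ) := rfl

theorem signC_mul_self {d : ℕ} (σ : Equiv.Perm (Fin d)) : signC σ * signC σ = 1 := by
  rw [signC_apply, ← Int.cast_mul, ← Units.val_mul, Int.units_mul_self]
  simp

theorem signC_inv {d : ℕ} (σ : Equiv.Perm (Fin d)) : signC σ⁻¹ = signC σ := by
  rw [signC_apply, signC_apply, sign_inv]

theorem signC_eq {d : ℕ} {σ : Equiv.Perm (Fin d)} {μ : Nat.Partition d} (h : HasCycleType σ μ) :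
    signC σ = (-1) ^ (d + μ.parts.card) := by
  have hle : σ.cycleType.sum ≤ d := by simpa using σ.sum_cycleType_le
  have hcard : μ.parts.card = σ.cycleType.card + (d - σ.cycleType.sum) := by
    rw [← show fullCycleType σ = μ.parts from h]
    simp [fullCycleType]
  obtain ⟨k, hk⟩ := Nat.exists_eq_add_of_le hle
  have hexp : d + μ.parts.card = σ.cycleType.sum + σ.cycleType.card + 2 * k := by omega
  rw [signC_apply, sign_of_cycleType, hexp, pow_add _ _ (2 * k)]
  simp

/-- The twist of a representation of `S_d` by the sign character. -/
def twistRep {d : ℕ} {V : Type*} [AddCommGroup V] [Module ℂ V]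
    (ρ : Representation ℂ (Equiv.Perm (Fin d)) V) :
    Representation ℂ (Equiv.Perm (Fin d)) V where
  toFun σ := signC σ • ρ σ
  map_one' := by simp
  map_mul' σ τ := by rw [map_mul, map_mul, smul_mul_smul_comm]

theorem character_twistRep {d : ℕ} (V : FDRep ℂ (Equiv.Perm (Fin d))) :
    (FDRep.of (twistRep V.ρ)).character = ⇑signC * V.character := by
  ext σ
  exact map_smul (LinearMap.trace ℂ V) (signC σ) (V.ρ σ)

theorem IsIrredChar.signC_mul {d : ℕ} {χ : Equiv.Perm (Fin d) → ℂ} (h : IsIrredChar d χ) :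
    IsIrredChar d (⇑signC * χ) := by
  obtain ⟨V, hV, rfl⟩ := h
  refine ⟨FDRep.of (twistRep V.ρ), ?_, (character_twistRep V).symm⟩
  rw [FDRep.simple_iff_char_is_norm_one] at hV ⊢
  rw [← hV, character_twistRep]
  refine Finset.sum_congr rfl fun σ _ => ?_
  rw [Pi.mul_apply, Pi.mul_apply, signC_inv, mul_mul_mul_comm, signC_mul_self, one_mul]

/-- Multiplication by the sign character, as a permutation of the irreducible characters. -/
def signTwist (d : ℕ) : IrredChar d ≃ IrredChar d :=
  Function.Involutive.toPerm (fun χ => ⟨⇑signC * χ.1, χ.2.signC_mul⟩) fun χ => by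
    apply Subtype.ext
    ext σ
    simp only [Pi.mul_apply]
    rw [← mul_assoc, signC_mul_self, one_mul]

theorem signTwist_apply {d : ℕ} (χ : IrredChar d) (σ : Equiv.Perm (Fin d)) :
    (signTwist d χ).1 σ = signC σ * χ.1 σ := rfl

theorem fChar_signTwist {d : ℕ} (χ : IrredChar d) : fChar (signTwist d χ).1 = -fChar χ.1 := by
  rw [fChar, fChar, ← Finset.sum_neg_distrib]
  refine Finset.sum_congr rfl fun t ht => ?_
  have hsign : signC t = -1 := by
    rw [signC_apply, (Finset.mem_filter.mp ht).2.sign_eq]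
    simp
  rw [signTwist_apply, signTwist_apply, hsign, map_one, one_mul, neg_one_mul, neg_div]

theorem Phi_eq_neg {d : ℕ} {rep : Nat.Partition d → Equiv.Perm (Fin d)}
    (hrep : ∀ μ : Nat.Partition d, HasCycleType (rep μ) μ) (μ ν : Nat.Partition d) (lam : ℂ) :
    Phi rep μ ν lam = (-1) ^ (μ.parts.card + ν.parts.card) * Phi rep μ ν (-lam) := by
  have hsign : signC (rep μ) * signC (rep ν) = (-1) ^ (μ.parts.card + ν.parts.card) := by
    rw [signC_eq (hrep μ), signC_eq (hrep ν), ← pow_add,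
      show d + μ.parts.card + (d + ν.parts.card) = μ.parts.card + ν.parts.card + 2 * d by ring,
      pow_add _ _ (2 * d)]
    simp
  rw [Phi, Phi, ← finsum_comp_equiv (signTwist d), mul_finsum]
  refine finsum_congr fun χ => ?_
  rw [signTwist_apply, signTwist_apply, fChar_signTwist, ← hsign, neg_mul_comm]
  ring

end DoubleHurwitz

open DoubleHurwitz in
/-- **Parity relation for double Hurwitz generating functions.** -/
theorem double_hurwitz_parity (d : ℕ) (hd : 0 < d)
    (rep : Nat.Partition d → Equiv.Perm (Fin d))
    (hrep : ∀ μ : Nat.Partition d, HasCycleType (rep μ) μ)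
    (μ ν : Nat.Partition d) (lam : ℂ) :
    Phi rep μ ν (-lam) = (-1) ^ (μ.parts.card + ν.parts.card) * Phi rep μ ν lam ∧
    Phi rep μ ν lam = (-1) ^ (μ.parts.card + ν.parts.card) *
      ∑ᶠ χ : IrredChar d,
        (χ.1 (rep μ) / (zPart μ : ℂ)) * (χ.1 (rep ν) / (zPart ν : ℂ)) *
          Complex.exp (-(fChar χ.1) * lam) := by
  refine ⟨?_, ?_⟩
  · simpa using Phi_eq_neg hrep μ ν (-lam)
  · simpa only [Phi, neg_mul_comm] using Phi_eq_neg hrep μ ν lam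
end
end

section
/- Cut-or-join action of a transposition: let d be a positive integer, σ ∈ S_d a permutation, and a ≠ b two points of {1, …, d}, and let τ = (a b) be the transposition exchanging a and b. Regard the cycle type of a permutation as the partition of d formed by the lengths of all its cycles (counting fixed points as cycles of length 1). If a and b lie in the same cycle of σ, of length ℓ, then there exists an integer k with 1 ≤ k ≤ ℓ−1 such that the cycle type of σ·τ is obtained from that of σ by removing one part equal to ℓ and adding two parts equal to k and ℓ−k. If a and b lie in different cycles of σ, of lengths i and j respectively, then the cycle type of σ·τ is obtained from that of σ by removing one part equal to i and one part equal to j and adding one part equal to i+j. -/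
open scoped BigOperators Classical

noncomputable section

namespace DoubleHurwitz

/-- The length of the cycle of `σ` containing `a` (a fixed point lies in a cycle of
length 1): the size of the orbit of `a` under `σ`. -/
def cycleLen {d : ℕ} (σ : Equiv.Perm (Fin d)) (a : Fin d) : ℕ :=
  (Finset.univ.filter fun b : Fin d => σ.SameCycle a b).card

section SameCycle

variable {α : Type*}

theorem pow_mul_swap_apply [DecidableEq α] (σ : Equiv.Perm α) {a b : α} {k : ℕ}
    (h : ∀ i, 1 ≤ i → i < k → (σ ^ i) b ≠ a ∧ (σ ^ i) b ≠ b) :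
    ∀ i, 1 ≤ i → i ≤ k → ((σ * Equiv.swap a b) ^ i) a = (σ ^ i) b := by
  intro i hi
  induction i, hi using Nat.le_induction with
  | base => intro _; simp
  | succ i hi ih =>
    intro hk
    obtain ⟨h1, h2⟩ := h i hi (by omega)
    rw [pow_succ', Equiv.Perm.mul_apply, ih (by omega), pow_succ', Equiv.Perm.mul_apply,
      Equiv.Perm.mul_apply, Equiv.swap_apply_of_ne_of_ne h1 h2]

/-- A transposition of two points in different cycles joins these cycles. -/
theorem sameCycle_mul_swap [DecidableEq α] [Finite α] {σ : Equiv.Perm α} {a b : α}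
    (h : ¬ σ.SameCycle a b) :
    (σ * Equiv.swap a b).SameCycle a b := by
  classical
  have hex : ∃ k, 1 ≤ k ∧ (σ ^ k) b = b :=
    ⟨orderOf σ, orderOf_pos σ, by simp [pow_orderOf_eq_one]⟩
  obtain ⟨hk, hkb⟩ := Nat.find_spec hex
  refine ⟨Nat.find hex, ?_⟩
  rw [zpow_natCast, pow_mul_swap_apply σ (k := Nat.find hex) _ _ hk le_rfl, hkb]
  refine fun i hi hik ↦ ⟨fun hia ↦ h ?_, fun hib ↦ Nat.find_min hex hik ⟨hi, hib⟩⟩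
  exact Equiv.Perm.SameCycle.symm ⟨i, by simpa using hia⟩

/-- A transposition of two points in the same cycle cuts this cycle. -/
theorem not_sameCycle_mul_swap [DecidableEq α] [Finite α] {σ : Equiv.Perm α} {a b : α} (hab : a ≠ b)
    (h : σ.SameCycle a b) : ¬ (σ * Equiv.swap a b).SameCycle a b := by
  classical
  have hex : ∃ k, 1 ≤ k ∧ (σ ^ k) b = a := by
    obtain ⟨k, hk, -, hka⟩ := h.symm.exists_pow_eq''
    exact ⟨k, hk, hka⟩
  obtain ⟨hk, hka⟩ := Nat.find_spec hex
  set k := Nat.find hex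
  have hmin : ∀ i, 1 ≤ i → i < k → (σ ^ i) b ≠ a ∧ (σ ^ i) b ≠ b := by
    refine fun i hi hik ↦ ⟨fun hia ↦ Nat.find_min hex hik ⟨hi, hia⟩, fun hib ↦ ?_⟩
    refine Nat.find_min hex (m := k - i) (by omega) ⟨by omega, ?_⟩
    have : (σ ^ (k - i)) ((σ ^ i) b) = a := by
      rw [← Equiv.Perm.mul_apply, ← pow_add, Nat.sub_add_cancel hik.le, hka]
    rwa [hib] at this
  have hpow := pow_mul_swap_apply σ hmin
  have hper : ((σ * Equiv.swap a b) ^ k) a = a := by rw [hpow k hk le_rfl, hka]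
  intro hs
  obtain ⟨n, hn⟩ := hs.exists_nat_pow_eq
  rw [← Nat.mod_add_div n k, pow_add, Equiv.Perm.mul_apply, pow_mul,
    Equiv.Perm.pow_apply_eq_self_of_apply_eq_self hper] at hn
  rcases Nat.eq_zero_or_pos (n % k) with h0 | h0
  · rw [h0] at hn
    exact hab (by simpa using hn)
  · have hlt := Nat.mod_lt n hk
    rw [hpow _ h0 hlt.le] at hn
    exact (hmin _ h0 hlt).2 hn

theorem sameCycle_of_forall_apply {σ π : Equiv.Perm α} (h : ∀ x, π.SameCycle x (σ x)) {x y : α}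
    (hxy : σ.SameCycle x y) : π.SameCycle x y := by
  obtain ⟨n, rfl⟩ := hxy
  induction n using Int.induction_on with
  | zero => exact Equiv.Perm.SameCycle.refl π x
  | succ n ih =>
    rw [add_comm, zpow_add, zpow_one, Equiv.Perm.mul_apply]
    exact ih.trans (h _)
  | pred n ih =>
    refine ih.trans (Equiv.Perm.SameCycle.symm ?_)
    have := h ((σ ^ (-(n : ℤ) - 1)) x)
    rwa [← Equiv.Perm.mul_apply, ← zpow_one_add, add_sub_cancel] at this

theorem sameCycle_mul_swap_of_sameCycle [DecidableEq α] [Finite α] {σ : Equiv.Perm α} {a b : α}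
    (h : ¬ σ.SameCycle a b) {x y : α} (hxy : σ.SameCycle x y) :
    (σ * Equiv.swap a b).SameCycle x y := by
  have hj := sameCycle_mul_swap h
  refine sameCycle_of_forall_apply (fun x ↦ ?_) hxy
  have hstep : ∀ z, (σ * Equiv.swap a b).SameCycle z (σ (Equiv.swap a b z)) :=
    fun z ↦ ⟨1, by simp⟩
  by_cases hxa : x = a
  · subst hxa
    simpa using hj.trans (hstep b)
  by_cases hxb : x = b
  · subst hxb
    simpa using hj.symm.trans (hstep a)
  simpa [Equiv.swap_apply_of_ne_of_ne hxa hxb] using hstep x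

theorem sameCycle_of_sameCycle_mul_swap [DecidableEq α] [Finite α] {σ : Equiv.Perm α} {a b x y : α}
    (ha : ¬ σ.SameCycle a x) (hb : ¬ σ.SameCycle b x)
    (hxy : (σ * Equiv.swap a b).SameCycle x y) : σ.SameCycle x y := by
  obtain ⟨n, rfl⟩ := hxy.exists_nat_pow_eq
  clear hxy
  induction n with
  | zero => exact Equiv.Perm.SameCycle.refl σ x
  | succ n ih =>
    rw [pow_succ', Equiv.Perm.mul_apply, Equiv.Perm.mul_apply, Equiv.swap_apply_of_ne_of_ne]
    · exact Equiv.Perm.sameCycle_apply_right.2 ih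
    · intro h
      exact ha (h ▸ ih).symm
    · intro h
      exact hb (h ▸ ih).symm

end SameCycle

/-- The cycle of `σ` through `x`, as a set of points. -/
def orbitOf {d : ℕ} (σ : Equiv.Perm (Fin d)) (x : Fin d) : Finset (Fin d) :=
  Finset.univ.filter fun y => σ.SameCycle x y

theorem mem_orbitOf {d : ℕ} {σ : Equiv.Perm (Fin d)} {x y : Fin d} :
    y ∈ orbitOf σ x ↔ σ.SameCycle x y := by
  simp [orbitOf]

theorem orbitOf_eq_iff {d : ℕ} {σ : Equiv.Perm (Fin d)} {x y : Fin d} :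
    orbitOf σ x = orbitOf σ y ↔ σ.SameCycle x y := by
  refine ⟨fun h ↦ ?_, fun h ↦ ?_⟩
  · rw [← mem_orbitOf, h, mem_orbitOf]
  · ext z
    rw [mem_orbitOf, mem_orbitOf]
    exact ⟨h.symm.trans, h.trans⟩

/-- The set of all cycles of `σ`, fixed points included. -/
def orbits {d : ℕ} (σ : Equiv.Perm (Fin d)) : Finset (Finset (Fin d)) :=
  Finset.univ.image (orbitOf σ)

theorem orbitOf_eq_singleton {d : ℕ} {σ : Equiv.Perm (Fin d)} {x : Fin d} (hx : σ x = x) :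
    orbitOf σ x = {x} := by
  ext y
  rw [mem_orbitOf, Finset.mem_singleton]
  refine ⟨fun h ↦ ?_, fun h ↦ h ▸ Equiv.Perm.SameCycle.refl _ _⟩
  exact (h.eq_of_left hx).symm

theorem orbitOf_eq_support {d : ℕ} {σ : Equiv.Perm (Fin d)} {x : Fin d} (hx : σ x ≠ x) :
    orbitOf σ x = (σ.cycleOf x).support := by
  ext y
  rw [mem_orbitOf, Equiv.Perm.mem_support_cycleOf_iff' hx]

theorem fullCycleType_eq_map_card {d : ℕ} (σ : Equiv.Perm (Fin d)) :
    fullCycleType σ = (orbits σ).val.map Finset.card := by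
  have hsplit : orbits σ = (σ.cycleFactorsFinset.image Equiv.Perm.support).disjUnion
      (σ.supportᶜ.image fun x ↦ {x}) (by
        rw [Finset.disjoint_left]
        intro s hs hs'
        obtain ⟨c, hc, rfl⟩ := Finset.mem_image.1 hs
        obtain ⟨x, -, hx⟩ := Finset.mem_image.1 hs'
        have h2 := (Equiv.Perm.mem_cycleFactorsFinset_iff.1 hc).1.two_le_card_support
        rw [← hx, Finset.card_singleton] at h2
        omega) := by
    ext s
    simp only [orbits, Finset.mem_image, Finset.mem_disjUnion, Finset.mem_univ, true_and,
      Finset.mem_compl]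
    constructor
    · rintro ⟨x, rfl⟩
      by_cases hx : σ x = x
      · exact Or.inr ⟨x, by simpa using hx, (orbitOf_eq_singleton hx).symm⟩
      · exact Or.inl ⟨σ.cycleOf x,
          Equiv.Perm.cycleOf_mem_cycleFactorsFinset_iff.2 (Equiv.Perm.mem_support.2 hx),
          (orbitOf_eq_support hx).symm⟩
    · rintro (⟨c, hc, rfl⟩ | ⟨x, hx, rfl⟩)
      · obtain ⟨x, hx⟩ := (Equiv.Perm.mem_cycleFactorsFinset_iff.1 hc).1.nonempty_support
        have hσx := Equiv.Perm.mem_support.1 (Equiv.Perm.mem_cycleFactorsFinset_support_le hc hx)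
        exact ⟨x, by rw [orbitOf_eq_support hσx, ← Equiv.Perm.cycle_is_cycleOf hx hc]⟩
      · exact ⟨x, orbitOf_eq_singleton (by simpa using hx)⟩
  have hinj : Set.InjOn Equiv.Perm.support (σ.cycleFactorsFinset : Set (Equiv.Perm (Fin d))) := by
    intro c hc c' hc' h
    obtain ⟨x, hx⟩ := (Equiv.Perm.mem_cycleFactorsFinset_iff.1 hc).1.nonempty_support
    rw [Equiv.Perm.cycle_is_cycleOf hx hc,
      Equiv.Perm.cycle_is_cycleOf (show x ∈ c'.support from h ▸ hx) hc']
  rw [hsplit, Finset.disjUnion_val, Multiset.map_add, Finset.image_val_of_injOn hinj,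
    Finset.image_val_of_injOn Finset.singleton_injective.injOn, Multiset.map_map,
    Multiset.map_map, fullCycleType, Equiv.Perm.sum_cycleType, Equiv.Perm.cycleType_def]
  congr 1
  simp [Finset.card_compl]

theorem orbitOf_mul_swap_left {d : ℕ} {σ : Equiv.Perm (Fin d)} {a b : Fin d}
    (h : ¬ σ.SameCycle a b) :
    orbitOf (σ * Equiv.swap a b) a = orbitOf σ a ∪ orbitOf σ b := by
  ext y
  rw [Finset.mem_union, mem_orbitOf, mem_orbitOf, mem_orbitOf]
  constructor
  · intro hy
    by_contra! hn
    exact hn.1 (sameCycle_of_sameCycle_mul_swap hn.1 hn.2 hy.symm).symm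
  · rintro (hy | hy)
    · exact sameCycle_mul_swap_of_sameCycle h hy
    · exact (sameCycle_mul_swap h).trans (sameCycle_mul_swap_of_sameCycle h hy)

theorem orbitOf_mul_swap_of_not_sameCycle {d : ℕ} {σ : Equiv.Perm (Fin d)} {a b x : Fin d}
    (h : ¬ σ.SameCycle a b) (ha : ¬ σ.SameCycle a x) (hb : ¬ σ.SameCycle b x) :
    orbitOf (σ * Equiv.swap a b) x = orbitOf σ x := by
  ext y
  rw [mem_orbitOf, mem_orbitOf]
  exact ⟨sameCycle_of_sameCycle_mul_swap ha hb, sameCycle_mul_swap_of_sameCycle h⟩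

theorem cycleLen_mul_swap {d : ℕ} {σ : Equiv.Perm (Fin d)} {a b : Fin d}
    (h : ¬ σ.SameCycle a b) :
    cycleLen (σ * Equiv.swap a b) a = cycleLen σ a + cycleLen σ b := by
  have hd : Disjoint (orbitOf σ a) (orbitOf σ b) := by
    rw [Finset.disjoint_left]
    intro x hx hx'
    exact h ((mem_orbitOf.1 hx).trans (mem_orbitOf.1 hx').symm)
  exact (congrArg Finset.card (orbitOf_mul_swap_left h)).trans (Finset.card_union_of_disjoint hd)

theorem cycleLen_pos {d : ℕ} (σ : Equiv.Perm (Fin d)) (a : Fin d) : 0 < cycleLen σ a :=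
  Finset.card_pos.2 ⟨a, mem_orbitOf.2 (Equiv.Perm.SameCycle.refl σ a)⟩

theorem exists_fullCycleType_join {d : ℕ} {σ : Equiv.Perm (Fin d)} {a b : Fin d}
    (h : ¬ σ.SameCycle a b) :
    ∃ M : Multiset ℕ, fullCycleType σ = cycleLen σ a ::ₘ cycleLen σ b ::ₘ M ∧
      fullCycleType (σ * Equiv.swap a b) = (cycleLen σ a + cycleLen σ b) ::ₘ M := by
  set R := (orbits σ).filter fun s ↦ a ∉ s ∧ b ∉ s with hR
  have hself : ∀ x, x ∈ orbitOf σ x := fun x ↦ mem_orbitOf.2 (Equiv.Perm.SameCycle.refl σ x)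
  have hmemR : ∀ s, s ∈ R ↔ ∃ x, ¬ σ.SameCycle a x ∧ ¬ σ.SameCycle b x ∧ orbitOf σ x = s := by
    intro s
    simp only [hR, Finset.mem_filter, orbits, Finset.mem_image, Finset.mem_univ, true_and]
    constructor
    · rintro ⟨⟨x, rfl⟩, hx⟩
      rw [mem_orbitOf, mem_orbitOf, Equiv.Perm.sameCycle_comm, σ.sameCycle_comm (y := b)] at hx
      exact ⟨x, hx.1, hx.2, rfl⟩
    · rintro ⟨x, ha, hb, rfl⟩
      rw [mem_orbitOf, mem_orbitOf, Equiv.Perm.sameCycle_comm, σ.sameCycle_comm (y := b)]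
      exact ⟨⟨x, rfl⟩, ha, hb⟩
  have haR : ∀ s, a ∈ s → s ∉ R := fun s hs hsR ↦ (Finset.mem_filter.1 hsR).2.1 hs
  have hbR : ∀ s, b ∈ s → s ∉ R := fun s hs hsR ↦ (Finset.mem_filter.1 hsR).2.2 hs
  have h1 : orbits σ = insert (orbitOf σ a) (insert (orbitOf σ b) R) := by
    ext s
    simp only [Finset.mem_insert, hmemR]
    simp only [orbits, Finset.mem_image, Finset.mem_univ, true_and]
    constructor
    · rintro ⟨x, rfl⟩
      by_cases ha : σ.SameCycle a x
      · exact Or.inl (orbitOf_eq_iff.2 ha.symm)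
      by_cases hb : σ.SameCycle b x
      · exact Or.inr (Or.inl (orbitOf_eq_iff.2 hb.symm))
      exact Or.inr (Or.inr ⟨x, ha, hb, rfl⟩)
    · rintro (rfl | rfl | ⟨x, -, -, rfl⟩) <;> exact ⟨_, rfl⟩
  have h2 : orbits (σ * Equiv.swap a b) = insert (orbitOf (σ * Equiv.swap a b) a) R := by
    ext s
    simp only [Finset.mem_insert, hmemR]
    simp only [orbits, Finset.mem_image, Finset.mem_univ, true_and]
    constructor
    · rintro ⟨x, rfl⟩
      by_cases ha : σ.SameCycle a x
      · exact Or.inl (orbitOf_eq_iff.2 (sameCycle_mul_swap_of_sameCycle h ha).symm)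
      by_cases hb : σ.SameCycle b x
      · exact Or.inl (orbitOf_eq_iff.2
          ((sameCycle_mul_swap h).trans (sameCycle_mul_swap_of_sameCycle h hb)).symm)
      exact Or.inr ⟨x, ha, hb, (orbitOf_mul_swap_of_not_sameCycle h ha hb).symm⟩
    · rintro (rfl | ⟨x, ha, hb, rfl⟩)
      · exact ⟨_, rfl⟩
      · exact ⟨x, orbitOf_mul_swap_of_not_sameCycle h ha hb⟩
  refine ⟨R.val.map Finset.card, ?_, ?_⟩
  · rw [fullCycleType_eq_map_card, h1, Finset.insert_val_of_notMem, Finset.insert_val_of_notMem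
      (hbR _ (hself b)), Multiset.map_cons, Multiset.map_cons]
    · rfl
    · rw [Finset.mem_insert, orbitOf_eq_iff, not_or]
      exact ⟨h, haR _ (hself a)⟩
  · rw [fullCycleType_eq_map_card, h2, Finset.insert_val_of_notMem, Multiset.map_cons,
      ← cycleLen_mul_swap h]
    · rfl
    · exact haR _ (mem_orbitOf.2 (Equiv.Perm.SameCycle.refl _ a))

/-- **Cut-or-join action of a transposition.** -/
theorem cut_or_join (d : ℕ) (hd : 0 < d) (σ : Equiv.Perm (Fin d)) (a b : Fin d)
    (hab : a ≠ b) :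
    (σ.SameCycle a b →
      ∃ k : ℕ, 1 ≤ k ∧ k ≤ cycleLen σ a - 1 ∧
        fullCycleType (σ * Equiv.swap a b)
          = k ::ₘ (cycleLen σ a - k) ::ₘ (fullCycleType σ).erase (cycleLen σ a)) ∧
    (¬ σ.SameCycle a b →
      fullCycleType (σ * Equiv.swap a b)
        = (cycleLen σ a + cycleLen σ b) ::ₘ
            (((fullCycleType σ).erase (cycleLen σ a)).erase (cycleLen σ b))) := by
  constructor
  · intro h
    have h' := not_sameCycle_mul_swap hab h
    obtain ⟨M, hM, hM'⟩ := exists_fullCycleType_join h'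
    have hlen := cycleLen_mul_swap h'
    have hpa := cycleLen_pos (σ * Equiv.swap a b) a
    have hpb := cycleLen_pos (σ * Equiv.swap a b) b
    rw [Equiv.mul_swap_mul_self] at hM' hlen
    refine ⟨cycleLen (σ * Equiv.swap a b) a, hpa, by omega, ?_⟩
    rw [hM, hM', hlen, Multiset.erase_cons_head, Nat.add_sub_cancel_left]
  · intro h
    obtain ⟨M, hM, hM'⟩ := exists_fullCycleType_join h
    rw [hM', hM, Multiset.erase_cons_head, Multiset.erase_cons_head]

end DoubleHurwitz
end
end
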